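/- Let Y be a real Banach space, X a closed subspace of Y, ι : X → Y the inclusion and Q : Y → Y/X the quotient map. Let (Bₙ) be a sequence of bounded linear operators on Y with supₙ ‖Bₙ‖ < ∞, such that limₙ→∞ ‖Q ∘ Bₙ ∘ ι‖ = 0 and lim supₙ→∞ ‖Bₙ ∘ ι‖ ≤ 1. Then for every δ > 0 there is an infinite subset M of ℕ such that whenever n₁ < n₂ < ⋯ < n_k all lie in M, one has ‖B_{n₁} ∘ B_{n₂} ∘ ⋯ ∘ B_{n_k} ∘ ι‖ < 1 + δ. -/

import Mathlib

open Filter Topology NormedSpace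

/-- The quotient map `Y → Y ⧸ X` as a continuous linear map. -/
noncomputable def quotientCLM {Y : Type*} [NormedAddCommGroup Y] [NormedSpace ℝ Y]
    (X : Submodule ℝ Y) : Y →L[ℝ] Y ⧸ X :=
  X.mkQ.mkContinuous 1 fun y => by
    simpa using Submodule.Quotient.norm_mk_le X y

/-- Composing with an operator that nearly maps `X` to itself and is nearly contractive on `X`
changes the norm of the restriction to `X` only slightly. -/
theorem norm_comp_comp_subtypeL_le {Y : Type*} [NormedAddCommGroup Y] [NormedSpace ℝ Y]
    (X : Submodule ℝ Y) (T A : Y →L[ℝ] Y) {η : ℝ} (hη : 0 < η)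
    (hQ : ‖(quotientCLM X).comp (A.comp X.subtypeL)‖ < η / 2)
    (hA : ‖A.comp X.subtypeL‖ < 1 + η / 2) :
    ‖(T.comp A).comp X.subtypeL‖ ≤ ‖T.comp X.subtypeL‖ * (1 + η) + ‖T‖ * η := by
  refine ContinuousLinearMap.opNorm_le_bound _ (by positivity) fun x => ?_
  rcases eq_or_ne x 0 with rfl | hx
  · simp
  have hx : 0 < ‖x‖ := norm_pos_iff.mpr hx
  have hq : ‖(Submodule.Quotient.mk (A x) : Y ⧸ X)‖ < η / 2 * ‖x‖ :=
    (((quotientCLM X).comp (A.comp X.subtypeL)).le_opNorm x).trans_lt (by gcongr)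
  have hAx : ‖A x‖ ≤ (1 + η / 2) * ‖x‖ :=
    ((A.comp X.subtypeL).le_opNorm x).trans (by gcongr)
  obtain ⟨y, hy, hyn⟩ := QuotientAddGroup.norm_lt_iff.mp hq
  have hmem : A x - y ∈ X := (Submodule.Quotient.eq X).mp hy.symm
  have hnorm : ‖A x - y‖ ≤ (1 + η) * ‖x‖ := by
    have := norm_sub_le (A x) y
    linarith
  have hT : ‖T (A x - y)‖ ≤ ‖T.comp X.subtypeL‖ * ((1 + η) * ‖x‖) :=
    ((T.comp X.subtypeL).le_opNorm ⟨A x - y, hmem⟩).trans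
      (mul_le_mul_of_nonneg_left hnorm (norm_nonneg _))
  have hTy : ‖T y‖ ≤ ‖T‖ * (η * ‖x‖) :=
    (T.le_opNorm y).trans
      (mul_le_mul_of_nonneg_left (by nlinarith) (norm_nonneg _))
  calc ‖T (A x)‖ = ‖T (A x - y) + T y‖ := by rw [← map_add, sub_add_cancel]
    _ ≤ ‖T (A x - y)‖ + ‖T y‖ := norm_add_le _ _
    _ ≤ _ := by linarith

theorem foldr_comp_eq_foldr_comp_id {Y : Type*} [NormedAddCommGroup Y] [NormedSpace ℝ Y]
    (A : Y →L[ℝ] Y) (l : List (Y →L[ℝ] Y)) :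
    l.foldr ContinuousLinearMap.comp A =
      (l.foldr ContinuousLinearMap.comp (ContinuousLinearMap.id ℝ Y)).comp A := by
  induction l with
  | nil => simp
  | cons T l ih => rw [List.foldr_cons, ih, List.foldr_cons, ContinuousLinearMap.comp_assoc]

/-- Bounds on the increasing products of operators taken from the first `j` terms of a sufficiently
sparse subsequence. -/
theorem norm_foldr_comp_le {Y : Type*} [NormedAddCommGroup Y] [NormedSpace ℝ Y]
    (X : Submodule ℝ Y) (B : ℕ → Y →L[ℝ] Y) {K δ : ℝ} (hK : 1 ≤ K) (hδ : 0 < δ)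
    (hB : ∀ n, ‖B n‖ ≤ K) {φ : ℕ → ℕ} (hφ : StrictMono φ) {η : ℕ → ℝ} (hη : ∀ j, 0 < η j)
    (hηδ : ∀ j, (1 + δ + K ^ j) * η j ≤ δ * (1 / 2) ^ (j + 1))
    (hQ : ∀ j, ‖(quotientCLM X).comp ((B (φ j)).comp X.subtypeL)‖ < η j / 2)
    (hX : ∀ j, ‖(B (φ j)).comp X.subtypeL‖ < 1 + η j / 2)
    (l : List ℕ) (hl : l.Pairwise (· < ·)) (j : ℕ) (hj : ∀ m ∈ l, ∃ i < j, φ i = m) :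
    ‖(l.map B).foldr ContinuousLinearMap.comp (ContinuousLinearMap.id ℝ Y)‖ ≤ K ^ j ∧
      ‖((l.map B).foldr ContinuousLinearMap.comp (ContinuousLinearMap.id ℝ Y)).comp X.subtypeL‖ ≤
        1 + δ * (1 - (1 / 2) ^ j) := by
  induction l using List.reverseRecOn generalizing j with
  | nil =>
    have hpow : ((1 : ℝ) / 2) ^ j ≤ 1 := pow_le_one₀ (by norm_num) (by norm_num)
    refine ⟨ContinuousLinearMap.norm_id_le.trans (one_le_pow₀ hK), ?_⟩
    have : ‖X.subtypeL‖ ≤ 1 := X.norm_subtypeL_le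
    simp only [List.map_nil, List.foldr_nil, ContinuousLinearMap.id_comp]
    nlinarith
  | append_singleton l m ih =>
    obtain ⟨i, hij, rfl⟩ := hj m (by simp)
    rw [List.pairwise_append] at hl
    obtain ⟨hT, hTX⟩ := ih hl.1 i fun m hm => by
      obtain ⟨i', -, rfl⟩ := hj m (by simp [hm])
      exact ⟨i', hφ.lt_iff_lt.mp (hl.2.2 _ hm _ (by simp)), rfl⟩
    simp only [List.map_append, List.map_cons, List.map_nil, List.foldr_append, List.foldr_cons,
      List.foldr_nil, ContinuousLinearMap.comp_id]
    rw [foldr_comp_eq_foldr_comp_id]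
    set T := (l.map B).foldr ContinuousLinearMap.comp (ContinuousLinearMap.id ℝ Y)
    constructor
    · calc ‖T.comp (B (φ i))‖ ≤ ‖T‖ * ‖B (φ i)‖ := T.opNorm_comp_le _
        _ ≤ K ^ i * K := by gcongr; exact hB _
        _ = K ^ (i + 1) := (pow_succ K i).symm
        _ ≤ K ^ j := pow_le_pow_right₀ hK hij
    · have hpow : ((1 : ℝ) / 2) ^ j ≤ (1 / 2) ^ (i + 1) :=
        pow_le_pow_of_le_one (by norm_num) (by norm_num) hij
      have hpos : (0 : ℝ) < (1 / 2) ^ i := by positivity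
      have hi := hη i
      have hTX' : ‖T.comp X.subtypeL‖ ≤ 1 + δ := by nlinarith
      calc ‖(T.comp (B (φ i))).comp X.subtypeL‖
          ≤ ‖T.comp X.subtypeL‖ * (1 + η i) + ‖T‖ * η i :=
            norm_comp_comp_subtypeL_le X T _ hi (hQ i) (hX i)
        _ = ‖T.comp X.subtypeL‖ + (‖T.comp X.subtypeL‖ + ‖T‖) * η i := by ring
        _ ≤ (1 + δ * (1 - (1 / 2) ^ i)) + (1 + δ + K ^ i) * η i := by gcongr
        _ ≤ (1 + δ * (1 - (1 / 2) ^ i)) + δ * (1 / 2) ^ (i + 1) := add_le_add_right (hηδ i) _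
        _ = 1 + δ * (1 - (1 / 2) ^ (i + 1)) := by ring
        _ ≤ 1 + δ * (1 - (1 / 2) ^ j) := by gcongr

/-- Lemma on products of operators: if `‖Q ∘ Bₙ ∘ ι‖ → 0` and `limsup ‖Bₙ ∘ ι‖ ≤ 1`, then
there is an infinite set `M ⊆ ℕ` along which all increasing products satisfy
`‖B_{n₁} ∘ ⋯ ∘ B_{n_k} ∘ ι‖ < 1 + δ`. -/
theorem statement_8 (Y : Type*) [NormedAddCommGroup Y] [NormedSpace ℝ Y] [CompleteSpace Y]
    (X : Submodule ℝ Y) (hX : IsClosed (X : Set Y))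
    (B : ℕ → Y →L[ℝ] Y) (C : ℝ) (hC : ∀ n, ‖B n‖ ≤ C)
    (h1 : Tendsto (fun n => ‖(quotientCLM X).comp ((B n).comp X.subtypeL)‖) atTop (nhds 0))
    (h2 : Filter.limsup (fun n => ‖(B n).comp X.subtypeL‖) atTop ≤ 1)
    (δ : ℝ) (hδ : 0 < δ) :
    ∃ M : Set ℕ, M.Infinite ∧ ∀ l : List ℕ, l ≠ [] → l.Chain' (· < ·) → (∀ m ∈ l, m ∈ M) →
      ‖((l.map B).foldr ContinuousLinearMap.comp (ContinuousLinearMap.id ℝ Y)).comp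
          X.subtypeL‖ < 1 + δ := by
  set K := max C 1
  have hK : 1 ≤ K := le_max_right _ _
  have hB : ∀ n, ‖B n‖ ≤ K := fun n => (hC n).trans (le_max_left _ _)
  have hden : ∀ j : ℕ, 0 < 1 + δ + K ^ j := fun j => by positivity
  set η : ℕ → ℝ := fun j => δ * (1 / 2) ^ (j + 1) / (1 + δ + K ^ j)
  have hη : ∀ j, 0 < η j := fun j => div_pos (by positivity) (hden j)
  have hbdd : IsBoundedUnder (· ≤ ·) atTop fun n => ‖(B n).comp X.subtypeL‖ :=
    isBoundedUnder_of ⟨K, fun n => ((B n).opNorm_comp_le _).trans <|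
      (mul_le_of_le_one_right (norm_nonneg _) X.norm_subtypeL_le).trans (hB n)⟩
  obtain ⟨φ, hφ, hφη⟩ := extraction_forall_of_eventually
    (P := fun j n => ‖(quotientCLM X).comp ((B n).comp X.subtypeL)‖ < η j / 2 ∧
      ‖(B n).comp X.subtypeL‖ < 1 + η j / 2)
    fun j => (h1.eventually_lt_const (half_pos (hη j))).and <|
      eventually_lt_of_limsup_lt (h2.trans_lt (by linarith [hη j])) hbdd
  refine ⟨Set.range φ, Set.infinite_range_of_injective hφ.injective, fun l _ hl hM => ?_⟩
  obtain ⟨j, hj⟩ : ∃ j, ∀ m ∈ l, ∃ i < j, φ i = m := by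
    refine ⟨l.sum + 1, fun m hm => ?_⟩
    obtain ⟨i, rfl⟩ := hM m hm
    exact ⟨i, Nat.lt_succ_of_le ((hφ.id_le i).trans (List.single_le_sum (by simp) _ hm)), rfl⟩
  have := (norm_foldr_comp_le X B hK hδ hB hφ hη (fun j => (mul_div_cancel₀ _ (hden j).ne').le)
    (fun j => (hφη j).1) (fun j => (hφη j).2) l (List.isChain_iff_pairwise.mp hl) j hj).2
  have hpos : (0 : ℝ) < (1 / 2) ^ j := by positivity
  nlinarith
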